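/- Let i_1,…,i_{d−k+1} be a valid sequence of maximal length for the tropical matroid polytope P, so that B := [d+1]∖{i_1,…,i_{d−k+1}} is a basis of 𝓜, say B = B_m, and let T^0 = type_V(0). Then the componentwise intersection of the types of the pseudovertices 0, e_{i_1}, e_{i_1,i_2}, …, e_{i_1,…,i_{d−k+1}} is the type T = (T_1,…,T_{d+1}) with T_{i_l} = T^0_{i_l} ∖ (T^0_{i_1} ∪ ⋯ ∪ T^0_{i_{l−1}}) for l = 1,…,d−k+1, and T_j = {m} for every j ∈ B; in particular every entry of T is nonempty. -/

import Mathlib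

open Finset

noncomputable section

variable {d n : ℕ}

/-- `x ∈ tconv {v i}`, at the level of representatives in `ℝ^{d+1}` modulo constants. -/
def InTconv {ι : Type*} (v : ι → Fin (d + 1) → ℝ) (x : Fin (d + 1) → ℝ) : Prop :=
  ∃ (lam : ι → ℝ) (c : ℝ), ∀ j, x j + c = ⨅ i, (lam i + v i j)

/-- the `k`-th entry of the type of `x` with respect to the generators `v` -/
def typeEntry {ι : Type*} (v : ι → Fin (d + 1) → ℝ) (x : Fin (d + 1) → ℝ)
    (k : Fin (d + 1)) : Set ι :=
  {i | v i k - x k = ⨅ j, (v i j - x j)}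

/-- the spanning subgraph of `G` whose edges are those indexed by `B` -/
def edgeGraph {W : Type*} (G : SimpleGraph W) (ε : Fin (d + 1) ≃ G.edgeSet)
    (B : Finset (Fin (d + 1))) : SimpleGraph W :=
  SimpleGraph.fromEdgeSet {s | ∃ i ∈ B, (ε i : Sym2 W) = s}

/-- `B ⊆ [d+1]` is the edge set of a spanning tree of `G` -/
def IsSpanningTreeEdges {W : Type*} (G : SimpleGraph W) (ε : Fin (d + 1) ≃ G.edgeSet)
    (B : Finset (Fin (d + 1))) : Prop :=
  (edgeGraph G ε B).IsTree

/-- generators of the tropical matroid polytope, in canonical coordinates -/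
def gen (Bs : Fin n → Finset (Fin (d + 1))) (l : Fin n) (i : Fin (d + 1)) : ℝ :=
  if i ∈ Bs l then 0 else 1

/-- data of the cycle matroid of a connected bridgeless simple graph `G` whose `d+1` edges are
enumerated by `ε` and whose bases (spanning-tree edge sets, each of rank/cardinality `k`) are
enumerated without repetition by `Bs`. -/
structure MatroidData (d n k : ℕ) (W : Type) (G : SimpleGraph W)
    (ε : Fin (d + 1) ≃ G.edgeSet) (Bs : Fin n → Finset (Fin (d + 1))) : Prop where
  connected : G.Connected
  bridgeless : ∀ i : Fin (d + 1), ¬ G.IsBridge (ε i : Sym2 W)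
  tree : ∀ l, IsSpanningTreeEdges G ε (Bs l)
  inj : Function.Injective Bs
  all : ∀ B : Finset (Fin (d + 1)), IsSpanningTreeEdges G ε B → ∃ l, Bs l = B
  card : ∀ l, (Bs l).card = k

/-- minimum of `f` over a subset of coordinates (as an infimum) -/
def tmin (I : Set (Fin (d + 1))) (f : Fin (d + 1) → ℝ) : ℝ := sInf (f '' I)

/-- the closed tropical halfspace with apex `p` and type `I` -/
def Halfspace (p : Fin (d + 1) → ℝ) (I : Set (Fin (d + 1))) : Set (Fin (d + 1) → ℝ) :=
  {x | tmin I (fun i => x i - p i) ≤ tmin Iᶜ (fun j => x j - p j)}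

/-- the closed cell of the tropical complex containing `p` -/
def closedCell {ι : Type*} (v : ι → Fin (d + 1) → ℝ) (p : Fin (d + 1) → ℝ) :
    Set (Fin (d + 1) → ℝ) :=
  {x | ∀ k, typeEntry v p k ⊆ typeEntry v x k}

/-- the (closed) cells of the tropical complex `𝒞_V` -/
def IsCell {ι : Type*} (v : ι → Fin (d + 1) → ℝ) (X : Set (Fin (d + 1) → ℝ)) : Prop :=
  ∃ p, X = closedCell v p

/-- the chart `c₀ : 𝕋^d → ℝ^d` -/
def chart (x : Fin (d + 1) → ℝ) (i : Fin d) : ℝ := x i.succ - x 0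

/-- a bounded cell of the tropical complex (bounded as a subset of `𝕋^d ≅ ℝ^d`) -/
def IsBoundedCell {ι : Type*} (v : ι → Fin (d + 1) → ℝ) (X : Set (Fin (d + 1) → ℝ)) : Prop :=
  IsCell v X ∧ Bornology.IsBounded (chart '' X)

/-- an inclusion-maximal bounded cell -/
def IsMaxBoundedCell {ι : Type*} (v : ι → Fin (d + 1) → ℝ) (X : Set (Fin (d + 1) → ℝ)) : Prop :=
  IsBoundedCell v X ∧ ∀ Y, IsBoundedCell v Y → X ⊆ Y → Y = X

/-- an inclusion-maximal cell -/
def IsMaxCell {ι : Type*} (v : ι → Fin (d + 1) → ℝ) (X : Set (Fin (d + 1) → ℝ)) : Prop :=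
  IsCell v X ∧ ∀ Y, IsCell v Y → X ⊆ Y → Y = X

/-- a point of the relative interior of a cell `X`: a point of `X` whose type is
componentwise contained in the type of every point of `X` -/
def IsInteriorPoint {ι : Type*} (v : ι → Fin (d + 1) → ℝ) (X : Set (Fin (d + 1) → ℝ))
    (x : Fin (d + 1) → ℝ) : Prop :=
  x ∈ X ∧ ∀ y ∈ X, ∀ k, typeEntry v x k ⊆ typeEntry v y k

/-- `b_{I,J}`: the number of bases `B` with `I ⊆ B` and `J ∩ B = ∅` -/
def bIJ (Bs : Fin n → Finset (Fin (d + 1))) (I J : Finset (Fin (d + 1))) : ℕ :=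
  (Finset.univ.filter fun l => I ⊆ Bs l ∧ Disjoint J (Bs l)).card

/-- a pseudovertex of the tropical complex: the unique point of `𝕋^d` of its type -/
def IsPseudovertex {ι : Type*} (v : ι → Fin (d + 1) → ℝ) (x : Fin (d + 1) → ℝ) : Prop :=
  ∀ y, (∀ k, typeEntry v y k = typeEntry v x k) → ∃ c : ℝ, y = fun j => x j + c

/-- the pseudovertex `e_{i₁,…,i_s} = -e_J`, `J = [d+1] ∖ {σ 0,…,σ (s-1)}`, in canonical
coordinates: coordinate `1` at `σ 0, …, σ (s-1)` and `0` elsewhere -/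
def ptSeq {r : ℕ} (σ : Fin r → Fin (d + 1)) (s : ℕ) (j : Fin (d + 1)) : ℝ :=
  if ∃ t : Fin r, (t : ℕ) < s ∧ σ t = j then 1 else 0

/-- the generators `-e_I`, `|I| = k`, of the tropical hypersimplex `Δ_k^d`, in
canonical coordinates -/
def genU (d k : ℕ) : {I : Finset (Fin (d + 1)) // I.card = k} → Fin (d + 1) → ℝ :=
  fun I j => if j ∈ I.1 then 0 else 1

/-- the componentwise intersection of the types of the pseudovertices
`0 = e_∅, e_{i₁}, e_{i₁,i₂}, …, e_{i₁,…,i_r}` of a (valid) sequence `σ = (i₁,…,i_r)` -/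
def seqType {d n : ℕ} (Bs : Fin n → Finset (Fin (d + 1))) {r : ℕ}
    (σ : Fin r → Fin (d + 1)) (j : Fin (d + 1)) : Set (Fin n) :=
  ⋂ s ∈ Finset.range (r + 1), typeEntry (gen Bs) (ptSeq σ s) j

theorem mem_typeEntry_iff {ι : Type*} (v : ι → Fin (d + 1) → ℝ) (x : Fin (d + 1) → ℝ)
    (k : Fin (d + 1)) (a : ι) :
    a ∈ typeEntry v x k ↔ ∀ j, v a k - x k ≤ v a j - x j := by
  have hbdd : BddBelow (Set.range fun j => v a j - x j) := (Set.finite_range _).bddBelow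
  constructor
  · intro h j
    exact (show v a k - x k = _ from h).trans_le (ciInf_le hbdd j)
  · exact fun h => le_antisymm (le_ciInf h) (ciInf_le hbdd k)

theorem mem_seqType_iff (Bs : Fin n → Finset (Fin (d + 1))) {r : ℕ}
    (σ : Fin r → Fin (d + 1)) (j : Fin (d + 1)) (a : Fin n) :
    a ∈ seqType Bs σ j ↔
      ∀ s ≤ r, ∀ i, gen Bs a j - ptSeq σ s j ≤ gen Bs a i - ptSeq σ s i := by
  simp [seqType, mem_typeEntry_iff]

theorem gen_of_mem {Bs : Fin n → Finset (Fin (d + 1))} {a : Fin n} {i : Fin (d + 1)}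
    (h : i ∈ Bs a) : gen Bs a i = 0 := if_pos h

theorem gen_of_notMem {Bs : Fin n → Finset (Fin (d + 1))} {a : Fin n} {i : Fin (d + 1)}
    (h : i ∉ Bs a) : gen Bs a i = 1 := if_neg h

theorem gen_nonneg (Bs : Fin n → Finset (Fin (d + 1))) (a : Fin n) (i : Fin (d + 1)) :
    0 ≤ gen Bs a i := by
  unfold gen; split_ifs <;> norm_num

theorem ptSeq_le_one {r : ℕ} (σ : Fin r → Fin (d + 1)) (s : ℕ) (j : Fin (d + 1)) :
    ptSeq σ s j ≤ 1 := by
  unfold ptSeq; split_ifs <;> norm_num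

theorem ptSeq_apply_of_lt {r : ℕ} (σ : Fin r → Fin (d + 1)) {s : ℕ} {t : Fin r}
    (h : (t : ℕ) < s) : ptSeq σ s (σ t) = 1 := if_pos ⟨t, h, rfl⟩

theorem ptSeq_eq_zero {r : ℕ} {σ : Fin r → Fin (d + 1)} {s : ℕ} {j : Fin (d + 1)}
    (h : ∀ t : Fin r, (t : ℕ) < s → σ t ≠ j) : ptSeq σ s j = 0 :=
  if_neg fun ⟨t, ht, e⟩ => h t ht e

theorem seqType_apply (Bs : Fin n → Finset (Fin (d + 1))) {r : ℕ} (σ : Fin r → Fin (d + 1))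
    (hσ : Function.Injective σ) (hne : ∀ a, (Bs a).Nonempty) (l : Fin r) :
    seqType Bs σ (σ l) =
      {a : Fin n | σ l ∈ Bs a} \ ⋃ (t : Fin r) (_ : t < l), {a : Fin n | σ t ∈ Bs a} := by
  ext a
  simp only [mem_seqType_iff, Set.mem_sdiff, Set.mem_ofPred_eq, Set.mem_iUnion, exists_prop,
    not_exists, not_and]
  constructor
  · intro h
    refine ⟨?_, fun t htl hta => ?_⟩
    · by_contra hla
      obtain ⟨i, hi⟩ := hne a
      have h0 := h 0 (Nat.zero_le _) i
      rw [ptSeq_eq_zero (by simp), ptSeq_eq_zero (by simp), gen_of_mem hi,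
        gen_of_notMem hla] at h0
      norm_num at h0
    · have h1 := h l l.2.le (σ t)
      rw [ptSeq_apply_of_lt σ htl, gen_of_mem hta,
        ptSeq_eq_zero fun u hu e => (hσ e ▸ hu).ne rfl] at h1
      linarith [gen_nonneg Bs a (σ l)]
  · rintro ⟨hla, hlt⟩ s - i
    rw [gen_of_mem hla]
    rcases lt_or_ge (l : ℕ) s with hs | hs
    · rw [ptSeq_apply_of_lt σ hs]
      linarith [gen_nonneg Bs a i, ptSeq_le_one σ s i]
    · rw [ptSeq_eq_zero fun u hu e => (hσ e ▸ hu).not_ge hs]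
      by_cases hi : i ∈ Bs a
      · have hz : ptSeq σ s i = 0 := by
          refine ptSeq_eq_zero fun u hu e => hlt u (Fin.lt_def.2 (hu.trans_le hs)) ?_
          rwa [e]
        rw [gen_of_mem hi, hz]
      · rw [gen_of_notMem hi]
        linarith [ptSeq_le_one σ s i]

theorem seqType_of_mem_compl (Bs : Fin n → Finset (Fin (d + 1))) {r : ℕ}
    (σ : Fin r → Fin (d + 1)) (hinj : Function.Injective Bs)
    (hcard : ∀ a b, (Bs a).card = (Bs b).card) (m : Fin n)
    (hB : ∀ j : Fin (d + 1), j ∈ Bs m ↔ ∀ t, σ t ≠ j) {j : Fin (d + 1)} (hj : j ∈ Bs m) :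
    seqType Bs σ j = {m} := by
  have hzero : ∀ s, ∀ i ∈ Bs m, ptSeq σ s i = 0 := fun s i hi =>
    ptSeq_eq_zero fun t _ => (hB i).1 hi t
  ext a
  rw [mem_seqType_iff, Set.mem_singleton_iff]
  constructor
  · intro h
    refine hinj (Finset.eq_of_subset_of_card_le (fun i hi => ?_) (hcard m a).le)
    by_contra him
    obtain ⟨t, rfl⟩ : ∃ t, σ t = i := by simpa using mt (hB i).2 him
    have h1 := h r le_rfl (σ t)
    rw [hzero r j hj, gen_of_mem hi, ptSeq_apply_of_lt σ t.2] at h1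
    linarith [gen_nonneg Bs a j]
  · rintro rfl s - i
    rw [hzero s j hj, gen_of_mem hj]
    by_cases hi : i ∈ Bs a
    · rw [hzero s i hi, gen_of_mem hi]
    · rw [gen_of_notMem hi]
      linarith [ptSeq_le_one σ s i]

theorem edgeGraph_adj {W : Type*} {G : SimpleGraph W} {ε : Fin (d + 1) ≃ G.edgeSet}
    {B : Finset (Fin (d + 1))} {u v : W} :
    (edgeGraph G ε B).Adj u v ↔ ∃ i ∈ B, (ε i : Sym2 W) = s(u, v) := by
  simp only [edgeGraph, SimpleGraph.fromEdgeSet_adj, Set.mem_ofPred_eq, and_iff_left_iff_imp]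
  rintro ⟨i, -, hi⟩
  exact G.ne_of_adj (G.mem_edgeSet.1 (hi ▸ (ε i).2))

theorem IsSpanningTreeEdges.nonempty {W : Type*} {G : SimpleGraph W}
    {ε : Fin (d + 1) ≃ G.edgeSet} {B : Finset (Fin (d + 1))}
    (h : IsSpanningTreeEdges G ε B) : B.Nonempty := by
  obtain ⟨e, he⟩ := ε 0
  induction e with | _ u v =>
  have : Nontrivial W := ⟨u, v, G.ne_of_adj he⟩
  obtain ⟨w, hw⟩ := h.connected.preconnected.exists_adj_of_nontrivial u
  obtain ⟨i, hi, -⟩ := edgeGraph_adj.1 hw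
  exact ⟨i, hi⟩

/-- Every edge of `G` can be exchanged into a given spanning tree. -/
theorem IsSpanningTreeEdges.exists_subset_insert {W : Type*} {G : SimpleGraph W}
    {ε : Fin (d + 1) ≃ G.edgeSet} {B : Finset (Fin (d + 1))}
    (h : IsSpanningTreeEdges G ε B) (e : Fin (d + 1)) :
    ∃ B', IsSpanningTreeEdges G ε B' ∧ e ∈ B' ∧ B' ⊆ insert e B := by
  classical
  obtain ⟨u, v, huv⟩ : ∃ u v, (ε e : Sym2 W) = s(u, v) := by
    induction (ε e : Sym2 W) with | _ u v => exact ⟨u, v, rfl⟩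
  have hne : u ≠ v := G.ne_of_adj (G.mem_edgeSet.1 (huv ▸ (ε e).2))
  have hle : edgeGraph G ε B ≤ edgeGraph G ε (insert e B) := fun x y hxy => by
    obtain ⟨i, hi, hxy⟩ := edgeGraph_adj.1 hxy
    exact edgeGraph_adj.2 ⟨i, Finset.mem_insert_of_mem hi, hxy⟩
  have hacyc : (⊥ ⊔ SimpleGraph.edge u v).IsAcyclic :=
    SimpleGraph.isAcyclic_bot.sup_edge_of_not_reachable (by simpa using hne)
  have hedge : ⊥ ⊔ SimpleGraph.edge u v ≤ edgeGraph G ε (insert e B) := by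
    rw [bot_sup_eq, SimpleGraph.edge_le_iff]
    exact Or.inr (edgeGraph_adj.2 ⟨e, Finset.mem_insert_self _ _, huv⟩)
  obtain ⟨F, hF, hF', hFtree⟩ :=
    (h.connected.mono hle).exists_isTree_le_of_le_of_isAcyclic hedge hacyc
  have hFG : F = edgeGraph G ε {i | (ε i : Sym2 W) ∈ F.edgeSet} := by
    ext x y
    simp only [edgeGraph_adj, Finset.mem_filter_univ]
    constructor
    · intro hxy
      obtain ⟨i, -, hi⟩ := edgeGraph_adj.1 (hF' hxy)
      exact ⟨i, hi ▸ hxy, hi⟩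
    · rintro ⟨i, hi, hxy⟩
      rwa [hxy] at hi
  refine ⟨_, hFG ▸ hFtree, ?_, fun i hi => ?_⟩
  · rw [Finset.mem_filter_univ, huv]
    exact hF (Or.inr (by simp [SimpleGraph.edge_adj, hne]))
  · rw [Finset.mem_filter_univ] at hi
    generalize hs : (ε i : Sym2 W) = s at hi
    induction s with | _ x y =>
    obtain ⟨i', hi', hxy⟩ := edgeGraph_adj.1 (hF' hi)
    rwa [← ε.injective (Subtype.ext (hxy.trans hs.symm))]

/-- For a valid sequence `i₁, …, i_{d-k+1}` of maximal length, whose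
complement is the basis `B_m`, the componentwise intersection `T` of the types of the
pseudovertices `0, e_{i₁}, …, e_{i₁,…,i_{d-k+1}}` satisfies
`T_{i_l} = T⁰_{i_l} ∖ (T⁰_{i₁} ∪ ⋯ ∪ T⁰_{i_{l-1}})` and `T_j = {m}` for `j ∈ B_m`;
in particular every entry of `T` is nonempty. -/
theorem seqType_tropicalMatroidPolytope
    (d n k : ℕ) (W : Type) [Fintype W] (G : SimpleGraph W)
    (ε : Fin (d + 1) ≃ G.edgeSet) (Bs : Fin n → Finset (Fin (d + 1)))
    (hM : MatroidData d n k W G ε Bs)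
    (σ : Fin (d + 1 - k) → Fin (d + 1)) (hσ : Function.Injective σ)
    (m : Fin n) (hB : ∀ j : Fin (d + 1), j ∈ Bs m ↔ ∀ t, σ t ≠ j) :
    (∀ l : Fin (d + 1 - k),
      seqType Bs σ (σ l) =
        {a : Fin n | σ l ∈ Bs a} \
          ⋃ (t : Fin (d + 1 - k)) (_ : t < l), {a : Fin n | σ t ∈ Bs a}) ∧
    (∀ j ∈ Bs m, seqType Bs σ j = {m}) ∧
    (∀ j : Fin (d + 1), (seqType Bs σ j).Nonempty) := by
  have hne : ∀ a, (Bs a).Nonempty := fun a => (hM.tree a).nonempty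
  have hcompl : ∀ j ∈ Bs m, seqType Bs σ j = {m} := fun j hj =>
    seqType_of_mem_compl Bs σ hM.inj (fun a b => (hM.card a).trans (hM.card b).symm) m hB hj
  refine ⟨seqType_apply Bs σ hσ hne, hcompl, fun j => ?_⟩
  by_cases hj : j ∈ Bs m
  · exact hcompl j hj ▸ Set.singleton_nonempty m
  obtain ⟨l, rfl⟩ : ∃ l, σ l = j := by simpa using mt (hB j).2 hj
  obtain ⟨B', hB', hl, hsub⟩ := (hM.tree m).exists_subset_insert (σ l)
  obtain ⟨a, rfl⟩ := hM.all B' hB'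
  refine ⟨a, ?_⟩
  rw [seqType_apply Bs σ hσ hne]
  simp only [Set.mem_sdiff, Set.mem_ofPred_eq, Set.mem_iUnion, exists_prop, not_exists, not_and]
  refine ⟨hl, fun t htl hta => ?_⟩
  rcases Finset.mem_insert.1 (hsub hta) with e | e
  · exact htl.ne (hσ e)
  · exact (hB _).1 e t rfl
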